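/- arXiv:2506.18558 — 6 statements merged into one kernel-verified Lean document; each statement's English description precedes it below -/
import Mathlib

section
/- Let f : [0,∞) × ℝⁿ × ℝᵐ → ℝᵐ satisfy the partial dissipativity condition with constants C, K, r₀ > 0, and suppose there exists C_* > 0 such that |f(t,x,0)| ≤ C_*(1+|x|) for all t ≥ 0 and x ∈ ℝⁿ. Then for every K₁ with 0 < K₁ < K there exists K₂ > 0 such that for all t ≥ 0, x ∈ ℝⁿ and y ∈ ℝᵐ, ⟨f(t,x,y), y⟩ ≤ −K₁|y|² + K₂(1+|x|²). -/
open MeasureTheory Filter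
open scoped RealInnerProductSpace

/-- if `f` satisfies the partial dissipativity condition with constants
`C, K, r₀ > 0` and `|f(t,x,0)| ≤ C_*(1+|x|)`, then for every `0 < K₁ < K` there exists
`K₂ > 0` with `⟨f(t,x,y), y⟩ ≤ −K₁|y|² + K₂(1+|x|²)`. -/
theorem stmt_1 {n m : ℕ}
    (f : ℝ → EuclideanSpace ℝ (Fin n) → EuclideanSpace ℝ (Fin m) → EuclideanSpace ℝ (Fin m))
    (C K r₀ Cs : ℝ) (hC : 0 < C) (hK : 0 < K) (hr₀ : 0 < r₀) (hCs : 0 < Cs)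
    (hdiss : ∀ t : ℝ, 0 ≤ t → ∀ (x₁ x₂ : EuclideanSpace ℝ (Fin n))
      (y₁ y₂ : EuclideanSpace ℝ (Fin m)),
      (‖y₁ - y₂‖ ≤ r₀ →
        ⟪f t x₁ y₁ - f t x₂ y₂, y₁ - y₂⟫ ≤ C * ‖y₁ - y₂‖ ^ 2 + C * ‖x₁ - x₂‖ * ‖y₁ - y₂‖) ∧
      (r₀ < ‖y₁ - y₂‖ →
        ⟪f t x₁ y₁ - f t x₂ y₂, y₁ - y₂⟫ ≤ -K * ‖y₁ - y₂‖ ^ 2 + C * ‖x₁ - x₂‖ * ‖y₁ - y₂‖))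
    (hgrow : ∀ t : ℝ, 0 ≤ t → ∀ x : EuclideanSpace ℝ (Fin n), ‖f t x 0‖ ≤ Cs * (1 + ‖x‖)) :
    ∀ K₁ : ℝ, 0 < K₁ → K₁ < K → ∃ K₂ : ℝ, 0 < K₂ ∧ ∀ t : ℝ, 0 ≤ t →
      ∀ (x : EuclideanSpace ℝ (Fin n)) (y : EuclideanSpace ℝ (Fin m)),
      ⟪f t x y, y⟫ ≤ -K₁ * ‖y‖ ^ 2 + K₂ * (1 + ‖x‖ ^ 2) := by
  intro K₁ _ hK₁K
  have hδ : 0 < K - K₁ := sub_pos.mpr hK₁K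
  refine ⟨(C + K) * r₀ ^ 2 + Cs ^ 2 / (2 * (K - K₁)), by positivity, fun t ht x y => ?_⟩
  obtain ⟨hnear, hfar⟩ := hdiss t ht x x y 0
  simp only [sub_zero, sub_self, norm_zero, mul_zero, zero_mul, add_zero,
    inner_sub_left] at hnear hfar
  have hcs : ⟪f t x 0, y⟫ ≤ Cs * (1 + ‖x‖) * ‖y‖ :=
    (real_inner_le_norm _ _).trans
      (mul_le_mul_of_nonneg_right (hgrow t ht x) (norm_nonneg y))
  have hmain : ⟪f t x y, y⟫ - ⟪f t x 0, y⟫ ≤ -K * ‖y‖ ^ 2 + (C + K) * r₀ ^ 2 := by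
    rcases le_or_gt ‖y‖ r₀ with h | h
    · have hsq : (C + K) * ‖y‖ ^ 2 ≤ (C + K) * r₀ ^ 2 := by gcongr
      linarith [hnear h]
    · have hpos : 0 ≤ (C + K) * r₀ ^ 2 := by positivity
      linarith [hfar h]
  have hyoung : Cs * (1 + ‖x‖) * ‖y‖ ≤
      (K - K₁) * ‖y‖ ^ 2 + Cs ^ 2 / (2 * (K - K₁)) * (1 + ‖x‖ ^ 2) := by
    have hgap : (K - K₁) * ‖y‖ ^ 2 + Cs ^ 2 / (2 * (K - K₁)) * (1 + ‖x‖ ^ 2) -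
        Cs * (1 + ‖x‖) * ‖y‖ =
        ((2 * (K - K₁) * ‖y‖ - Cs * (1 + ‖x‖)) ^ 2 + Cs ^ 2 * (1 - ‖x‖) ^ 2) /
          (4 * (K - K₁)) := by
      field_simp
      ring
    have hnonneg : 0 ≤ ((2 * (K - K₁) * ‖y‖ - Cs * (1 + ‖x‖)) ^ 2 +
        Cs ^ 2 * (1 - ‖x‖) ^ 2) / (4 * (K - K₁)) := by positivity
    linarith
  have hx : 0 ≤ (C + K) * r₀ ^ 2 * ‖x‖ ^ 2 := by positivity
  linarith
end

section
/- Let σ : [0,∞) × ℝⁿ → ℝ^{n×d} (real n×d matrices) satisfy, with a constant C₀ > 0, ‖σ(t,x₁) − σ(t,x₂)‖ ≤ C₀|x₁−x₂| for all t ≥ 0 and x₁, x₂ ∈ ℝⁿ, and suppose that for each x the map s ↦ ‖σ(s,x) − σ̄(x)‖² is locally integrable, where σ̄ : ℝⁿ → ℝ^{n×d} and φ₃ : (0,∞) → [0,∞) with φ₃(T) → 0 as T → ∞ satisfy sup_{t ≥ 0} (1/T) ∫_t^{t+T} ‖σ(s,x) − σ̄(x)‖² ds ≤ φ₃(T)(1+|x|²)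 for all T > 0 and x ∈ ℝⁿ. Then ‖σ̄(x₁) − σ̄(x₂)‖ ≤ C₀|x₁−x₂| for all x₁, x₂ ∈ ℝⁿ. -/
open MeasureTheory Filter

/-- if `σ(t,·)` is `C₀`-Lipschitz (operator norm) and
`sup_{t ≥ 0} (1/T)∫_t^{t+T} ‖σ(s,x) − σ̄(x)‖² ds ≤ φ₃(T)(1+|x|²)` with `φ₃(T) → 0`, then `σ̄`
is `C₀`-Lipschitz. Matrices in `ℝ^{n×d}` with the `ℓ²→ℓ²` operator norm are modeled as
continuous linear maps `EuclideanSpace ℝ (Fin d) →L[ℝ] EuclideanSpace ℝ (Fin n)`. -/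
theorem stmt_8 {n d : ℕ} (C₀ : ℝ) (hC₀ : 0 < C₀)
    (σ : ℝ → EuclideanSpace ℝ (Fin n) →
      (EuclideanSpace ℝ (Fin d) →L[ℝ] EuclideanSpace ℝ (Fin n)))
    (σbar : EuclideanSpace ℝ (Fin n) →
      (EuclideanSpace ℝ (Fin d) →L[ℝ] EuclideanSpace ℝ (Fin n)))
    (φ₃ : ℝ → ℝ)
    (hLip : ∀ t : ℝ, 0 ≤ t → ∀ x₁ x₂ : EuclideanSpace ℝ (Fin n),
      ‖σ t x₁ - σ t x₂‖ ≤ C₀ * ‖x₁ - x₂‖)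
    (hloc : ∀ x : EuclideanSpace ℝ (Fin n), ∀ a c : ℝ, 0 ≤ a →
      IntegrableOn (fun s => ‖σ s x - σbar x‖ ^ 2) (Set.Icc a c))
    (hφ₃_nonneg : ∀ T : ℝ, 0 < T → 0 ≤ φ₃ T)
    (hφ₃_lim : Tendsto φ₃ atTop (nhds 0))
    (havg : ∀ T : ℝ, 0 < T → ∀ t : ℝ, 0 ≤ t → ∀ x : EuclideanSpace ℝ (Fin n),
      (1 / T) * ∫ s in Set.Icc t (t + T), ‖σ s x - σbar x‖ ^ 2 ≤ φ₃ T * (1 + ‖x‖ ^ 2)) :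
    ∀ x₁ x₂ : EuclideanSpace ℝ (Fin n), ‖σbar x₁ - σbar x₂‖ ≤ C₀ * ‖x₁ - x₂‖ := by
  intro x₁ x₂
  by_contra! hgap
  set c := ‖σbar x₁ - σbar x₂‖ - C₀ * ‖x₁ - x₂‖ with hc
  have hc_pos : 0 < c := sub_pos.mpr hgap
  have hpoint : ∀ s : ℝ, 0 ≤ s →
      c ^ 2 / 2 ≤ ‖σ s x₁ - σbar x₁‖ ^ 2 + ‖σ s x₂ - σbar x₂‖ ^ 2 := by
    intro s hs
    have htri : ‖σbar x₁ - σbar x₂‖ ≤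
        ‖σ s x₁ - σbar x₁‖ + ‖σ s x₁ - σ s x₂‖ + ‖σ s x₂ - σbar x₂‖ := by
      calc ‖σbar x₁ - σbar x₂‖
          = ‖-(σ s x₁ - σbar x₁) + (σ s x₁ - σ s x₂) + (σ s x₂ - σbar x₂)‖ := by
            congr 1; abel
        _ ≤ _ := norm_add₃_le
        _ = _ := by rw [norm_neg]
    have hsum : c ≤ ‖σ s x₁ - σbar x₁‖ + ‖σ s x₂ - σbar x₂‖ := by
      linarith [hLip s hs x₁ x₂]
    nlinarith [sq_nonneg (‖σ s x₁ - σbar x₁‖ - ‖σ s x₂ - σbar x₂‖)]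
  have hbound : ∀ T : ℝ, 0 < T →
      c ^ 2 / 2 ≤ φ₃ T * ((1 + ‖x₁‖ ^ 2) + (1 + ‖x₂‖ ^ 2)) := by
    intro T hT
    have hint : ∫ _ in Set.Icc 0 (0 + T), c ^ 2 / 2 ≤
        ∫ s in Set.Icc 0 (0 + T), (‖σ s x₁ - σbar x₁‖ ^ 2 + ‖σ s x₂ - σbar x₂‖ ^ 2) :=
      setIntegral_mono_on (integrableOn_const (by simp))
        ((hloc x₁ 0 _ le_rfl).add (hloc x₂ 0 _ le_rfl)) measurableSet_Icc
        fun s hs => hpoint s hs.1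
    rw [integral_add (hloc x₁ 0 _ le_rfl) (hloc x₂ 0 _ le_rfl), setIntegral_const,
      Real.volume_real_Icc_of_le (by linarith), smul_eq_mul, zero_add, sub_zero] at hint
    have h₁ := havg T hT 0 le_rfl x₁
    have h₂ := havg T hT 0 le_rfl x₂
    rw [zero_add] at h₁ h₂
    calc c ^ 2 / 2 = 1 / T * (T * (c ^ 2 / 2)) := by field_simp
      _ ≤ 1 / T * _ := mul_le_mul_of_nonneg_left hint (by positivity)
      _ ≤ _ := by rw [mul_add, mul_add]; exact add_le_add h₁ h₂
  have hlim := hφ₃_lim.mul_const ((1 + ‖x₁‖ ^ 2) + (1 + ‖x₂‖ ^ 2))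
  rw [zero_mul] at hlim
  have hle : c ^ 2 / 2 ≤ 0 :=
    ge_of_tendsto hlim ((eventually_gt_atTop 0).mono hbound)
  have : 0 < c ^ 2 / 2 := by positivity
  linarith
end

section
/- Let γ > 0 and let A and B be real symmetric n×n matrices such that A − γI and B − γI are positive semidefinite (i.e. all eigenvalues of A and B are at least γ). Then ‖A^{1/2} − B^{1/2}‖ ≤ ‖A − B‖ / (2√γ), where M^{1/2} denotes the unique positive semidefinite square root of a positive semidefinite symmetric matrix M and ‖·‖ is the ℓ²→ℓ² operator norm. -/
open MeasureTheory Filter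
open scoped RealInnerProductSpace

section

variable {E : Type*} [NormedAddCommGroup E] [InnerProductSpace ℝ E] [FiniteDimensional ℝ E]

/-- A symmetric operator whose eigenvalues are all at least `c` is bounded below by `c`. -/
theorem LinearMap.IsSymmetric.le_inner_of_forall_eigenvalue {T : E →ₗ[ℝ] E} (hT : T.IsSymmetric)
    {c : ℝ} (h : ∀ (μ : ℝ) (v : E), ‖v‖ = 1 → T v = μ • v → c ≤ μ) (z : E) :
    c * ‖z‖ ^ 2 ≤ ⟪T z, z⟫ := by
  set b := hT.eigenvectorBasis rfl
  have hb : ∀ i, T (b i) = hT.eigenvalues rfl i • b i := fun i =>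
    hT.apply_eigenvectorBasis rfl i
  rw [← b.sum_inner_mul_inner (T z) z, ← b.sum_sq_norm_inner_right z, Finset.mul_sum]
  refine Finset.sum_le_sum fun i _ => ?_
  have hi := h _ _ (b.norm_eq_one i) (hb i)
  rw [hT z (b i), hb i, inner_smul_right, real_inner_comm, Real.norm_eq_abs, sq_abs]
  nlinarith [mul_le_mul_of_nonneg_right hi (sq_nonneg ⟪b i, z⟫)]

/-- A symmetric operator whose eigenvalues are all at most `M` in absolute value has operator norm
at most `M`. -/
theorem ContinuousLinearMap.opNorm_le_of_forall_abs_eigenvalue_le {T : E →L[ℝ] E}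
    (hT : (T : E →ₗ[ℝ] E).IsSymmetric) {M : ℝ} (hM : 0 ≤ M)
    (h : ∀ (μ : ℝ) (v : E), ‖v‖ = 1 → T v = μ • v → |μ| ≤ M) : ‖T‖ ≤ M := by
  refine T.opNorm_le_bound hM fun z => ?_
  set b := hT.eigenvectorBasis rfl
  have hb : ∀ i, T (b i) = hT.eigenvalues rfl i • b i := fun i =>
    hT.apply_eigenvectorBasis rfl i
  refine le_of_sq_le_sq ?_ (by positivity)
  rw [mul_pow, ← b.sum_sq_norm_inner_right (T z), ← b.sum_sq_norm_inner_right z, Finset.mul_sum]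
  refine Finset.sum_le_sum fun i _ => ?_
  have hi := h _ _ (b.norm_eq_one i) (hb i)
  have hs : ⟪b i, T z⟫ = hT.eigenvalues rfl i * ⟪b i, z⟫ := by
    have := hT (b i) z
    simp only [ContinuousLinearMap.coe_coe] at this
    rw [← this, hb i, real_inner_smul_left]
  rw [hs, norm_mul, mul_pow, Real.norm_eq_abs]
  gcongr

/-- If `S` is positive semidefinite and `S ^ 2` is bounded below by `γ`, then `S` is bounded below
by `√γ`. -/
theorem ContinuousLinearMap.sqrt_mul_norm_sq_le_inner {S : E →L[ℝ] E} {γ : ℝ}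
    (hS : (S : E →ₗ[ℝ] E).IsSymmetric) (hpos : ∀ z, 0 ≤ ⟪S z, z⟫)
    (hsq : ∀ z, γ * ‖z‖ ^ 2 ≤ ⟪S (S z), z⟫) (z : E) : √γ * ‖z‖ ^ 2 ≤ ⟪S z, z⟫ := by
  refine hS.le_inner_of_forall_eigenvalue (fun μ v hv hμ => ?_) z
  replace hμ : S v = μ • v := hμ
  have h0 := hpos v
  have h1 := hsq v
  simp only [hμ, map_smul, real_inner_smul_left, real_inner_self_eq_norm_sq, hv, one_pow,
    mul_one] at h0 h1
  exact Real.sqrt_le_iff.mpr ⟨h0, by nlinarith⟩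

end

/-- if `A` and `B` are real symmetric `n×n` matrices whose eigenvalues are all
at least `γ > 0` (i.e. `A − γI, B − γI` are positive semidefinite), then
`‖A^{1/2} − B^{1/2}‖ ≤ ‖A − B‖/(2√γ)`. Matrices are modeled as continuous linear maps on
`EuclideanSpace ℝ (Fin n)` with the operator norm; symmetry is self-adjointness, and the
square roots are encoded by their defining properties (positive semidefinite, symmetric,
squaring to the given matrix), which determine them uniquely. -/
theorem stmt_12 {n : ℕ} (γ : ℝ) (hγ : 0 < γ)
    (A B sqA sqB : EuclideanSpace ℝ (Fin n) →L[ℝ] EuclideanSpace ℝ (Fin n))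
    (hAsa : IsSelfAdjoint A) (hBsa : IsSelfAdjoint B)
    (hAγ : ∀ z : EuclideanSpace ℝ (Fin n), γ * ‖z‖ ^ 2 ≤ ⟪A z, z⟫)
    (hBγ : ∀ z : EuclideanSpace ℝ (Fin n), γ * ‖z‖ ^ 2 ≤ ⟪B z, z⟫)
    (hsqAsa : IsSelfAdjoint sqA)
    (hsqApos : ∀ z : EuclideanSpace ℝ (Fin n), 0 ≤ ⟪sqA z, z⟫)
    (hsqA : sqA.comp sqA = A)
    (hsqBsa : IsSelfAdjoint sqB)
    (hsqBpos : ∀ z : EuclideanSpace ℝ (Fin n), 0 ≤ ⟪sqB z, z⟫)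
    (hsqB : sqB.comp sqB = B) :
    ‖sqA - sqB‖ ≤ ‖A - B‖ / (2 * Real.sqrt γ) := by
  have hA := ContinuousLinearMap.sqrt_mul_norm_sq_le_inner hsqAsa.isSymmetric hsqApos
    (γ := γ) (fun z => by simpa [← hsqA] using hAγ z)
  have hB := ContinuousLinearMap.sqrt_mul_norm_sq_le_inner hsqBsa.isSymmetric hsqBpos
    (γ := γ) (fun z => by simpa [← hsqB] using hBγ z)
  have hs : 0 < √γ := Real.sqrt_pos.mpr hγ
  refine ContinuousLinearMap.opNorm_le_of_forall_abs_eigenvalue_le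
    (hsqAsa.sub hsqBsa).isSymmetric (by positivity) fun μ v hv hμ => ?_
  have hAv := hA v
  have hBv := hB v
  rw [hv, one_pow, mul_one] at hAv hBv
  have hsum : ⟪(A - B) v, v⟫ = μ * (⟪sqA v, v⟫ + ⟪sqB v, v⟫) := by
    have hsplit : (A - B) v = sqA ((sqA - sqB) v) + (sqA - sqB) (sqB v) := by
      simp [← hsqA, ← hsqB]
    have hsymm : ⟪(sqA - sqB) (sqB v), v⟫ = ⟪sqB v, (sqA - sqB) v⟫ :=
      (hsqAsa.sub hsqBsa).isSymmetric (sqB v) v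
    rw [hsplit, inner_add_left, hsymm, hμ, map_smul, real_inner_smul_left, real_inner_smul_right]
    ring
  rw [le_div_iff₀ (by positivity)]
  calc |μ| * (2 * √γ) ≤ |μ| * (⟪sqA v, v⟫ + ⟪sqB v, v⟫) := by gcongr; linarith
    _ = |⟪(A - B) v, v⟫| := by
      rw [hsum, abs_mul, abs_of_nonneg (add_nonneg (hsqApos v) (hsqBpos v))]
    _ ≤ ‖(A - B) v‖ * ‖v‖ := abs_real_inner_le_norm _ _
    _ ≤ ‖A - B‖ := by simpa [hv] using (A - B).le_opNorm v
end

section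
/- Let Σ̄ : ℝⁿ → ℝ^{n×n} take values in the real symmetric n×n matrices, and suppose there are constants γ > 0 and C > 0 such that for all x, x₁, x₂ ∈ ℝⁿ and z ∈ ℝⁿ: ⟨Σ̄(x) z, z⟩ ≥ γ|z|², ‖Σ̄(x₁) − Σ̄(x₂)‖ ≤ C(1+|x₁|+|x₂|)|x₁−x₂|, and ‖Σ̄(x)‖ ≤ C(1+|x|²). Define Θ(x) := Σ̄(x)^{1/2}, the positive semidefinite square root. Then there exists a constant C' > 0 such that for all x, x₁, x₂ ∈ ℝⁿ: ‖Θ(x₁) − Θ(x₂)‖ ≤ C'(1+|x₁|+|x₂|)|x₁−x₂| and ‖Θ(x)‖ ≤ C'(1+|x|). -/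
open MeasureTheory Filter
open scoped RealInnerProductSpace

section SelfAdjoint

variable {E : Type*} [NormedAddCommGroup E] [InnerProductSpace ℝ E] [FiniteDimensional ℝ E]

/-- The operator norm of a self-adjoint operator is bounded by any bound on its eigenvalues. -/
lemma IsSelfAdjoint.opNorm_le_of_eigenvalue_bound {T : E →L[ℝ] E} (hT : IsSelfAdjoint T) {M : ℝ}
    (hM : 0 ≤ M) (h : ∀ (μ : ℝ) (v : E), ‖v‖ = 1 → T v = μ • v → |μ| ≤ M) : ‖T‖ ≤ M := by
  have hs : (T : E →ₗ[ℝ] E).IsSymmetric := hT.isSymmetric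
  set b := hs.eigenvectorBasis rfl
  have hev : ∀ i, T (b i) = hs.eigenvalues rfl i • b i := fun i =>
    hs.apply_eigenvectorBasis rfl i
  have hle : ∀ i, |hs.eigenvalues rfl i| ≤ M := fun i =>
    h _ _ (b.orthonormal.1 i) (hev i)
  refine T.opNorm_le_bound hM fun z => ?_
  refine (sq_le_sq₀ (norm_nonneg _) (by positivity)).1 ?_
  rw [mul_pow, ← b.sum_sq_norm_inner_right (T z), ← b.sum_sq_norm_inner_right z, Finset.mul_sum]
  refine Finset.sum_le_sum fun i _ => ?_
  have hi : ⟪b i, T z⟫ = hs.eigenvalues rfl i * ⟪b i, z⟫ := by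
    rw [← real_inner_smul_left, ← hev i]
    exact (hs (b i) z).symm
  rw [hi, norm_mul, mul_pow, Real.norm_eq_abs]
  gcongr
  exact hle i

/-- If all eigenvalues of a self-adjoint operator are at least `c`, so is its quadratic form. -/
lemma IsSelfAdjoint.le_inner_of_le_eigenvalue {T : E →L[ℝ] E} (hT : IsSelfAdjoint T) {c : ℝ}
    (h : ∀ (μ : ℝ) (v : E), ‖v‖ = 1 → T v = μ • v → c ≤ μ) (z : E) :
    c * ‖z‖ ^ 2 ≤ ⟪T z, z⟫ := by
  have hs : (T : E →ₗ[ℝ] E).IsSymmetric := hT.isSymmetric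
  set b := hs.eigenvectorBasis rfl
  have hev : ∀ i, T (b i) = hs.eigenvalues rfl i • b i := fun i =>
    hs.apply_eigenvectorBasis rfl i
  have hle : ∀ i, c ≤ hs.eigenvalues rfl i := fun i =>
    h _ _ (b.orthonormal.1 i) (hev i)
  rw [← b.sum_sq_norm_inner_right z, ← b.sum_inner_mul_inner (T z) z, Finset.mul_sum]
  refine Finset.sum_le_sum fun i _ => ?_
  have hi : ⟪T z, b i⟫ = hs.eigenvalues rfl i * ⟪b i, z⟫ := by
    rw [real_inner_comm, ← real_inner_smul_left, ← hev i]
    exact (hs (b i) z).symm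
  rw [hi, mul_assoc, ← sq, Real.norm_eq_abs, sq_abs]
  exact mul_le_mul_of_nonneg_right (hle i) (sq_nonneg _)

/-- If `A` is positive semidefinite and `A ^ 2 ≥ γ`, then `A ≥ √γ`. -/
lemma sqrt_mul_norm_sq_le_inner_of_sq {A : E →L[ℝ] E} (hA : IsSelfAdjoint A)
    (hpos : ∀ z, 0 ≤ ⟪A z, z⟫) {γ : ℝ} (h : ∀ z, γ * ‖z‖ ^ 2 ≤ ⟪A (A z), z⟫) (z : E) :
    √γ * ‖z‖ ^ 2 ≤ ⟪A z, z⟫ := by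
  refine hA.le_inner_of_le_eigenvalue (fun μ v hv hAv => ?_) z
  have h₀ := hpos v
  have h₁ := h v
  simp only [hAv, map_smul, real_inner_smul_left, real_inner_self_eq_norm_sq, hv] at h₀ h₁
  exact Real.sqrt_le_iff.2 ⟨by linarith, by linarith⟩

/-- If `A` and `B` are self-adjoint and bounded below by `c > 0`, then
`‖A - B‖ ≤ ‖A ^ 2 - B ^ 2‖ / (2 * c)`. -/
lemma norm_sub_le_norm_sq_sub_sq_div {A B : E →L[ℝ] E} (hA : IsSelfAdjoint A)
    (hB : IsSelfAdjoint B) {c : ℝ} (hc : 0 < c) (hAc : ∀ z, c * ‖z‖ ^ 2 ≤ ⟪A z, z⟫)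
    (hBc : ∀ z, c * ‖z‖ ^ 2 ≤ ⟪B z, z⟫) :
    ‖A - B‖ ≤ ‖A.comp A - B.comp B‖ / (2 * c) := by
  refine (hA.sub hB).opNorm_le_of_eigenvalue_bound (by positivity) fun μ v hv hμ => ?_
  have hAv : A v = B v + μ • v := by
    rw [← hμ]; simp
  have key : ⟪(A.comp A - B.comp B) v, v⟫ = μ * (⟪A v, v⟫ + ⟪B v, v⟫) := by
    have e₁ : ⟪A (A v), v⟫ = ⟪A v, A v⟫ := hA.isSymmetric (A v) v
    have e₂ : ⟪B (B v), v⟫ = ⟪B v, B v⟫ := hB.isSymmetric (B v) v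
    simp only [sub_apply, ContinuousLinearMap.comp_apply, inner_sub_left, e₁, e₂]
    rw [hAv]
    simp only [inner_add_left, inner_add_right, real_inner_smul_left, real_inner_smul_right,
      real_inner_comm v (B v)]
    ring
  have hub : |⟪(A.comp A - B.comp B) v, v⟫| ≤ ‖A.comp A - B.comp B‖ := by
    refine (abs_real_inner_le_norm _ _).trans ?_
    simpa [hv] using (A.comp A - B.comp B).le_opNorm v
  have h₁ := hAc v
  have h₂ := hBc v
  rw [hv] at h₁ h₂
  rw [key, abs_mul, abs_of_pos (show 0 < ⟪A v, v⟫ + ⟪B v, v⟫ by linarith)] at hub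
  rw [le_div_iff₀ (by positivity)]
  refine le_trans ?_ hub
  gcongr
  linarith

end SelfAdjoint

/-- if `Σ̄(x)` is symmetric with `⟨Σ̄(x)z,z⟩ ≥ γ|z|²`,
`‖Σ̄(x₁) − Σ̄(x₂)‖ ≤ C(1+|x₁|+|x₂|)|x₁−x₂|` and `‖Σ̄(x)‖ ≤ C(1+|x|²)`, and `Θ(x)` is the
positive semidefinite square root of `Σ̄(x)`, then there is `C' > 0` with
`‖Θ(x₁) − Θ(x₂)‖ ≤ C'(1+|x₁|+|x₂|)|x₁−x₂|` and `‖Θ(x)‖ ≤ C'(1+|x|)`. Matrices are modeled as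
continuous linear maps on `EuclideanSpace ℝ (Fin n)` with the operator norm, and the square
root is encoded by its defining properties. -/
theorem stmt_13 {n : ℕ} (γ C : ℝ) (hγ : 0 < γ) (hC : 0 < C)
    (Sbar Th : EuclideanSpace ℝ (Fin n) →
      (EuclideanSpace ℝ (Fin n) →L[ℝ] EuclideanSpace ℝ (Fin n)))
    (hsa : ∀ x : EuclideanSpace ℝ (Fin n), IsSelfAdjoint (Sbar x))
    (hpos : ∀ (x z : EuclideanSpace ℝ (Fin n)), γ * ‖z‖ ^ 2 ≤ ⟪Sbar x z, z⟫)
    (hLip : ∀ x₁ x₂ : EuclideanSpace ℝ (Fin n),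
      ‖Sbar x₁ - Sbar x₂‖ ≤ C * (1 + ‖x₁‖ + ‖x₂‖) * ‖x₁ - x₂‖)
    (hgrow : ∀ x : EuclideanSpace ℝ (Fin n), ‖Sbar x‖ ≤ C * (1 + ‖x‖ ^ 2))
    (hThsa : ∀ x : EuclideanSpace ℝ (Fin n), IsSelfAdjoint (Th x))
    (hThpos : ∀ (x z : EuclideanSpace ℝ (Fin n)), 0 ≤ ⟪Th x z, z⟫)
    (hThsq : ∀ x : EuclideanSpace ℝ (Fin n), (Th x).comp (Th x) = Sbar x) :
    ∃ C' : ℝ, 0 < C' ∧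
      (∀ x₁ x₂ : EuclideanSpace ℝ (Fin n),
        ‖Th x₁ - Th x₂‖ ≤ C' * (1 + ‖x₁‖ + ‖x₂‖) * ‖x₁ - x₂‖) ∧
      ∀ x : EuclideanSpace ℝ (Fin n), ‖Th x‖ ≤ C' * (1 + ‖x‖) := by
  have hcoer : ∀ x z, √γ * ‖z‖ ^ 2 ≤ ⟪Th x z, z⟫ := fun x =>
    sqrt_mul_norm_sq_le_inner_of_sq (hThsa x) (hThpos x) fun z => by
      simpa only [← hThsq, ContinuousLinearMap.comp_apply] using hpos x z
  have hγ' : 0 < √γ := Real.sqrt_pos.2 hγ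
  refine ⟨C / (2 * √γ) + √C, by positivity, fun x₁ x₂ => ?_, fun x => ?_⟩
  · calc ‖Th x₁ - Th x₂‖ ≤ ‖Sbar x₁ - Sbar x₂‖ / (2 * √γ) := by
          simpa only [hThsq] using norm_sub_le_norm_sq_sub_sq_div (hThsa x₁) (hThsa x₂) hγ'
            (hcoer x₁) (hcoer x₂)
      _ ≤ C * (1 + ‖x₁‖ + ‖x₂‖) * ‖x₁ - x₂‖ / (2 * √γ) := by
          gcongr
          exact hLip x₁ x₂
      _ = C / (2 * √γ) * (1 + ‖x₁‖ + ‖x₂‖) * ‖x₁ - x₂‖ := by ring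
      _ ≤ (C / (2 * √γ) + √C) * (1 + ‖x₁‖ + ‖x₂‖) * ‖x₁ - x₂‖ := by
          gcongr
          exact le_add_of_nonneg_right (Real.sqrt_nonneg C)
  · have hsq : ‖Th x‖ ^ 2 ≤ (√C * (1 + ‖x‖)) ^ 2 := by
      rw [← (hThsa x).norm_mul_self, ContinuousLinearMap.mul_def, hThsq, mul_pow,
        Real.sq_sqrt hC.le]
      refine (hgrow x).trans ?_
      gcongr
      nlinarith [norm_nonneg x]
    calc ‖Th x‖ ≤ √C * (1 + ‖x‖) := (sq_le_sq₀ (norm_nonneg _) (by positivity)).1 hsq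
      _ ≤ (C / (2 * √γ) + √C) * (1 + ‖x‖) := by
          gcongr
          exact le_add_of_nonneg_left (by positivity)
end

section
/- Let b : [0,∞) × ℝⁿ × ℝᵐ → ℝⁿ satisfy, with a constant C₀ > 0, |b(t,x₁,y₁) − b(t,x₂,y₂)| ≤ C₀(|x₁−x₂| + |y₁−y₂|) and |b(t,x,y)| ≤ C₀(1+|x|+|y|) for all t ≥ 0, x, x₁, x₂ ∈ ℝⁿ, y, y₁, y₂ ∈ ℝᵐ, with b(t,x,·) Borel measurable. Let (μ^x_t)_{x ∈ ℝⁿ, t ≥ 0} be a family of Borel probability measures on ℝᵐ, and suppose there are constants C₁, C₂ > 0 such that ∫ |y| μ^x_t(dy) ≤ C₁(1+|x|) for all x and t, and for every L-Lipschitz function g : ℝᵐ → ℝ and all t ≥ 0, x₁, x₂ ∈ ℝⁿ: |∫ g dμ^{x₁}_t − ∫ g dμ^{x₂}_t| ≤ L·C₂|x₁−x₂|. Define b̄(t,x) := ∫ b(t,x,y) μ^x_t(dy). Then there exists a constant C > 0 such that for all t ≥ 0 and x, x₁, x₂ ∈ ℝⁿ: |b̄(t,x₁) − b̄(t,x₂)|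 ≤ C|x₁−x₂| and |b̄(t,x)| ≤ C(1+|x|). -/
open MeasureTheory Filter

/-- A bound on the difference of the integrals of real-valued Lipschitz functions against two
measures passes, with the same constant, to Lipschitz functions valued in an inner product space. -/
theorem norm_integral_sub_integral_le_of_lipschitz {E F : Type*} [NormedAddCommGroup E]
    [InnerProductSpace ℝ E] [CompleteSpace E] [PseudoMetricSpace F] [MeasurableSpace F]
    {μ ν : Measure F} {D : ℝ}
    (hD : ∀ (L : NNReal) (g : F → ℝ), LipschitzWith L g →
      |(∫ y, g y ∂μ) - ∫ y, g y ∂ν| ≤ L * D)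
    {K : NNReal} {f : F → E} (hf : LipschitzWith K f) (hμ : Integrable f μ)
    (hν : Integrable f ν) :
    ‖(∫ y, f y ∂μ) - ∫ y, f y ∂ν‖ ≤ K * D := by
  set v := (∫ y, f y ∂μ) - ∫ y, f y ∂ν with hv
  have hg : LipschitzWith (‖v‖₊ * K) fun y => inner ℝ v (f y) := by
    refine LipschitzWith.of_dist_le_mul fun y z => ?_
    rw [Real.dist_eq, ← inner_sub_right]
    calc |inner ℝ v (f y - f z)| ≤ ‖v‖ * ‖f y - f z‖ := abs_real_inner_le_norm _ _
      _ ≤ ‖v‖ * (K * dist y z) := by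
        gcongr
        simpa [dist_eq_norm] using hf.dist_le_mul y z
      _ = ↑(‖v‖₊ * K) * dist y z := by push_cast; ring
  have h := hD _ _ hg
  rw [integral_inner hμ, integral_inner hν, ← inner_sub_right, ← hv,
    real_inner_self_eq_norm_mul_norm, abs_mul_self] at h
  push_cast at h
  rcases (norm_nonneg v).eq_or_lt with h0 | h0
  · rw [← h0]
    have h1 := hD K (fun _ => 0) ((LipschitzWith.const 0).weaken zero_le)
    exact (abs_nonneg _).trans h1
  · exact le_of_mul_le_mul_left (by linarith) h0

/-- if `b` is `C₀`-Lipschitz in `(x,y)` with linear growth, and `(μ^x_t)` is a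
family of probability measures on `ℝᵐ` with uniformly bounded first moments
`∫|y| μ^x_t(dy) ≤ C₁(1+|x|)` and Lipschitz dependence on `x` against Lipschitz test
functions, then `b̄(t,x) := ∫ b(t,x,y) μ^x_t(dy)` is Lipschitz in `x` and of linear growth,
with a uniform constant. -/
theorem stmt_14 {n m : ℕ} (C₀ C₁ C₂ : ℝ) (hC₀ : 0 < C₀) (hC₁ : 0 < C₁) (hC₂ : 0 < C₂)
    (b : ℝ → EuclideanSpace ℝ (Fin n) → EuclideanSpace ℝ (Fin m) → EuclideanSpace ℝ (Fin n))
    (μ : EuclideanSpace ℝ (Fin n) → ℝ → Measure (EuclideanSpace ℝ (Fin m)))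
    (hprob : ∀ (x : EuclideanSpace ℝ (Fin n)) (t : ℝ), IsProbabilityMeasure (μ x t))
    (hbmeas : ∀ (t : ℝ) (x : EuclideanSpace ℝ (Fin n)), Measurable (fun y => b t x y))
    (hLip : ∀ t : ℝ, 0 ≤ t → ∀ (x₁ x₂ : EuclideanSpace ℝ (Fin n))
      (y₁ y₂ : EuclideanSpace ℝ (Fin m)),
      ‖b t x₁ y₁ - b t x₂ y₂‖ ≤ C₀ * (‖x₁ - x₂‖ + ‖y₁ - y₂‖))
    (hgrow : ∀ t : ℝ, 0 ≤ t → ∀ (x : EuclideanSpace ℝ (Fin n)) (y : EuclideanSpace ℝ (Fin m)),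
      ‖b t x y‖ ≤ C₀ * (1 + ‖x‖ + ‖y‖))
    (hmom : ∀ (x : EuclideanSpace ℝ (Fin n)) (t : ℝ), 0 ≤ t →
      ∫⁻ y, ‖y‖₊ ∂(μ x t) ≤ ENNReal.ofReal (C₁ * (1 + ‖x‖)))
    (hwass : ∀ (L : NNReal) (g : EuclideanSpace ℝ (Fin m) → ℝ), LipschitzWith L g →
      ∀ t : ℝ, 0 ≤ t → ∀ x₁ x₂ : EuclideanSpace ℝ (Fin n),
      |(∫ y, g y ∂(μ x₁ t)) - ∫ y, g y ∂(μ x₂ t)| ≤ (L : ℝ) * C₂ * ‖x₁ - x₂‖) :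
    ∃ C : ℝ, 0 < C ∧ ∀ t : ℝ, 0 ≤ t →
      (∀ x₁ x₂ : EuclideanSpace ℝ (Fin n),
        ‖(∫ y, b t x₁ y ∂(μ x₁ t)) - ∫ y, b t x₂ y ∂(μ x₂ t)‖ ≤ C * ‖x₁ - x₂‖) ∧
      ∀ x : EuclideanSpace ℝ (Fin n), ‖∫ y, b t x y ∂(μ x t)‖ ≤ C * (1 + ‖x‖) := by
  have hid : ∀ x t, 0 ≤ t → Integrable (fun y : EuclideanSpace ℝ (Fin m) => y) (μ x t) :=
    fun x t ht => ⟨measurable_id.aestronglyMeasurable,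
      (hmom x t ht).trans_lt ENNReal.ofReal_lt_top⟩
  have hbound : ∀ (x z : EuclideanSpace ℝ (Fin n)) t, 0 ≤ t →
      Integrable (fun y => C₀ * (1 + ‖x‖ + ‖y‖)) (μ z t) :=
    fun x z t ht => by
      have := hprob z t
      exact ((integrable_const _).add (hid z t ht).norm).const_mul _
  have hint : ∀ x z t, 0 ≤ t → Integrable (fun y => b t x y) (μ z t) := fun x z t ht =>
    (hbound x z t ht).mono' (hbmeas t x).aestronglyMeasurable
      (ae_of_all _ fun y => hgrow t ht x y)
  have hmean : ∀ x t, 0 ≤ t → ∫ y, ‖y‖ ∂(μ x t) ≤ C₁ * (1 + ‖x‖) := fun x t ht => by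
    rw [integral_norm_eq_lintegral_enorm (hid x t ht).1]
    exact ENNReal.toReal_le_of_le_ofReal (by positivity) (hmom x t ht)
  refine ⟨C₀ * (1 + C₁ + C₂), by positivity, fun t ht => ⟨fun x₁ x₂ => ?_, fun x => ?_⟩⟩
  · have := hprob x₁ t
    have hx : ‖(∫ y, b t x₁ y ∂(μ x₁ t)) - ∫ y, b t x₂ y ∂(μ x₁ t)‖ ≤ C₀ * ‖x₁ - x₂‖ := by
      rw [← integral_sub (hint _ _ t ht) (hint _ _ t ht)]
      simpa using norm_integral_le_of_norm_le_const (μ := μ x₁ t)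
        (ae_of_all _ fun y => by simpa using hLip t ht x₁ x₂ y y)
    have hLip₂ : LipschitzWith C₀.toNNReal (fun y => b t x₂ y) :=
      LipschitzWith.of_dist_le_mul fun y z => by
        simpa [dist_eq_norm, hC₀.le] using hLip t ht x₂ x₂ y z
    have hμ := norm_integral_sub_integral_le_of_lipschitz (D := C₂ * ‖x₁ - x₂‖)
      (fun L g hg => by simpa [mul_assoc] using hwass L g hg t ht x₁ x₂)
      hLip₂ (hint x₂ x₁ t ht) (hint x₂ x₂ t ht)
    rw [Real.coe_toNNReal _ hC₀.le] at hμ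
    calc ‖(∫ y, b t x₁ y ∂(μ x₁ t)) - ∫ y, b t x₂ y ∂(μ x₂ t)‖
        ≤ C₀ * ‖x₁ - x₂‖ + C₀ * (C₂ * ‖x₁ - x₂‖) :=
          (norm_sub_le_norm_sub_add_norm_sub _ _ _).trans (add_le_add hx hμ)
      _ ≤ C₀ * (1 + C₁ + C₂) * ‖x₁ - x₂‖ := by
        have : 0 ≤ C₀ * C₁ * ‖x₁ - x₂‖ := by positivity
        linarith
  · have := hprob x t
    calc ‖∫ y, b t x y ∂(μ x t)‖ ≤ ∫ y, C₀ * (1 + ‖x‖ + ‖y‖) ∂(μ x t) :=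
          norm_integral_le_of_norm_le (hbound x x t ht) (ae_of_all _ fun y => hgrow t ht x y)
      _ = C₀ * (1 + ‖x‖ + ∫ y, ‖y‖ ∂(μ x t)) := by
        rw [integral_const_mul, integral_add (integrable_const _) (hid x t ht).norm]
        simp
      _ ≤ C₀ * (1 + ‖x‖ + C₁ * (1 + ‖x‖)) := by
        gcongr
        exact hmean x t ht
      _ ≤ C₀ * (1 + C₁ + C₂) * (1 + ‖x‖) := by
        have : 0 ≤ C₀ * C₂ * (1 + ‖x‖) := by positivity
        linarith
end

section
/- Let Σ : ℝⁿ × ℝᵐ → ℝ^{n×n} (real n×n matrices) satisfy, with constants C > 0 and c > 0, ‖Σ(x₁,y₁) − Σ(x₂,y₂)‖ ≤ C(1+|x₁|+|x₂|)(|x₁−x₂| + |y₁−y₂|) and ⟨Σ(x,y) z, z⟩ ≥ c|z|² for all x, x₁, x₂ ∈ ℝⁿ, y, y₁, y₂ ∈ ℝᵐ, z ∈ ℝⁿ, with Σ(x,·) Borel measurable. Let (μ^x)_{x ∈ ℝⁿ} be a family of Borel probability measures on ℝᵐ with constants C₁, C₂ > 0 such that ∫ |y| μ^x(dy) ≤ C₁(1+|x|)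 for all x, and for every L-Lipschitz function g : ℝᵐ → ℝ and all x₁, x₂ ∈ ℝⁿ: |∫ g dμ^{x₁} − ∫ g dμ^{x₂}| ≤ L·C₂|x₁−x₂|. Define Σ̄(x) := ∫ Σ(x,y) μ^x(dy) (entrywise). Then there exists a constant C' > 0 such that for all x, x₁, x₂ ∈ ℝⁿ and z ∈ ℝⁿ: ‖Σ̄(x₁) − Σ̄(x₂)‖ ≤ C'(1+|x₁|+|x₂|)|x₁−x₂|, ‖Σ̄(x)‖ ≤ C'(1+|x|²), and ⟨Σ̄(x) z, z⟩ ≥ c|z|². -/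
open MeasureTheory Filter
open scoped RealInnerProductSpace

/-- A Lipschitz map is integrable against a finite measure with finite first moment. -/
theorem LipschitzWith.integrable_of_integrable_norm {E F : Type*} [NormedAddCommGroup E]
    [MeasurableSpace E] [OpensMeasurableSpace E] [SecondCountableTopology E]
    [NormedAddCommGroup F] {μ : Measure E} [IsFiniteMeasure μ] {K : NNReal} {f : E → F}
    (hf : LipschitzWith K f) (hμ : Integrable (fun y => ‖y‖) μ) : Integrable f μ := by
  refine ((hμ.const_mul (K : ℝ)).add (integrable_const ‖f 0‖)).mono'
    hf.continuous.aestronglyMeasurable (ae_of_all _ fun y => ?_)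
  have h := hf.norm_sub_le y 0
  rw [sub_zero] at h
  exact (norm_le_norm_sub_add (f y) (f 0)).trans (by simpa using h)

/-- If integrals of real Lipschitz functions against `μ` and `ν` differ by at most `d` times the
Lipschitz constant, the same holds for Lipschitz functions with values in a Banach space. -/
theorem norm_integral_sub_integral_le_of_lipschitzWith {E F : Type*} [PseudoEMetricSpace E]
    [MeasurableSpace E] [NormedAddCommGroup F] [NormedSpace ℝ F] [CompleteSpace F]
    {μ ν : Measure E} {d : ℝ}
    (hd : ∀ (L : NNReal) (g : E → ℝ), LipschitzWith L g →
      |(∫ y, g y ∂μ) - ∫ y, g y ∂ν| ≤ L * d)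
    {K : NNReal} {f : E → F} (hf : LipschitzWith K f) (hμ : Integrable f μ)
    (hν : Integrable f ν) : ‖(∫ y, f y ∂μ) - ∫ y, f y ∂ν‖ ≤ K * d := by
  obtain ⟨φ, hφ, hφv⟩ := exists_dual_vector'' ℝ ((∫ y, f y ∂μ) - ∫ y, f y ∂ν)
  have hlip : LipschitzWith K fun y => φ (f y) := by
    have h := (φ.lipschitz.weaken (K' := 1) hφ).comp hf
    rwa [one_mul] at h
  calc ‖(∫ y, f y ∂μ) - ∫ y, f y ∂ν‖ = φ ((∫ y, f y ∂μ) - ∫ y, f y ∂ν) := hφv.symm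
    _ = (∫ y, φ (f y) ∂μ) - ∫ y, φ (f y) ∂ν := by
      rw [map_sub, φ.integral_comp_comm hμ, φ.integral_comp_comm hν]
    _ ≤ K * d := (le_abs_self _).trans (hd K _ hlip)

/-- if `Σ` satisfies `‖Σ(x₁,y₁) − Σ(x₂,y₂)‖ ≤ C(1+|x₁|+|x₂|)(|x₁−x₂|+|y₁−y₂|)`
and `⟨Σ(x,y)z,z⟩ ≥ c|z|²`, and `(μ^x)` are probability measures with first moments
`≤ C₁(1+|x|)` and Lipschitz dependence on `x` against Lipschitz test functions, then
`Σ̄(x) := ∫ Σ(x,y) μ^x(dy)` satisfies `‖Σ̄(x₁) − Σ̄(x₂)‖ ≤ C'(1+|x₁|+|x₂|)|x₁−x₂|`,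
`‖Σ̄(x)‖ ≤ C'(1+|x|²)` and `⟨Σ̄(x)z,z⟩ ≥ c|z|²`. Matrices in `ℝ^{n×n}` with the `ℓ²→ℓ²`
operator norm are modeled as continuous linear maps, and the measure integral is the Bochner
(entrywise) integral. -/
theorem stmt_16 {n m : ℕ} (C c C₁ C₂ : ℝ) (hC : 0 < C) (hc : 0 < c) (hC₁ : 0 < C₁)
    (hC₂ : 0 < C₂)
    (Sig : EuclideanSpace ℝ (Fin n) → EuclideanSpace ℝ (Fin m) →
      (EuclideanSpace ℝ (Fin n) →L[ℝ] EuclideanSpace ℝ (Fin n)))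
    (μ : EuclideanSpace ℝ (Fin n) → Measure (EuclideanSpace ℝ (Fin m)))
    (hprob : ∀ x : EuclideanSpace ℝ (Fin n), IsProbabilityMeasure (μ x))
    (hSmeas : ∀ x : EuclideanSpace ℝ (Fin n), Measurable (fun y => Sig x y))
    (hSLip : ∀ (x₁ x₂ : EuclideanSpace ℝ (Fin n)) (y₁ y₂ : EuclideanSpace ℝ (Fin m)),
      ‖Sig x₁ y₁ - Sig x₂ y₂‖ ≤ C * (1 + ‖x₁‖ + ‖x₂‖) * (‖x₁ - x₂‖ + ‖y₁ - y₂‖))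
    (hSpos : ∀ (x : EuclideanSpace ℝ (Fin n)) (y : EuclideanSpace ℝ (Fin m))
      (z : EuclideanSpace ℝ (Fin n)), c * ‖z‖ ^ 2 ≤ ⟪Sig x y z, z⟫)
    (hmom : ∀ x : EuclideanSpace ℝ (Fin n),
      ∫⁻ y, ‖y‖₊ ∂(μ x) ≤ ENNReal.ofReal (C₁ * (1 + ‖x‖)))
    (hwass : ∀ (L : NNReal) (g : EuclideanSpace ℝ (Fin m) → ℝ), LipschitzWith L g →
      ∀ x₁ x₂ : EuclideanSpace ℝ (Fin n),
      |(∫ y, g y ∂(μ x₁)) - ∫ y, g y ∂(μ x₂)| ≤ (L : ℝ) * C₂ * ‖x₁ - x₂‖) :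
    ∃ C' : ℝ, 0 < C' ∧
      (∀ x₁ x₂ : EuclideanSpace ℝ (Fin n),
        ‖(∫ y, Sig x₁ y ∂(μ x₁)) - ∫ y, Sig x₂ y ∂(μ x₂)‖ ≤
          C' * (1 + ‖x₁‖ + ‖x₂‖) * ‖x₁ - x₂‖) ∧
      (∀ x : EuclideanSpace ℝ (Fin n), ‖∫ y, Sig x y ∂(μ x)‖ ≤ C' * (1 + ‖x‖ ^ 2)) ∧
      ∀ (x : EuclideanSpace ℝ (Fin n)) (z : EuclideanSpace ℝ (Fin n)),
        c * ‖z‖ ^ 2 ≤ ⟪(∫ y, Sig x y ∂(μ x)) z, z⟫ := by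
  have hnorm : ∀ x, Integrable (fun y => ‖y‖) (μ x) := fun x =>
    Integrable.norm ⟨continuous_id.aestronglyMeasurable,
      (hmom x).trans_lt ENNReal.ofReal_lt_top⟩
  have hlip : ∀ x, LipschitzWith (C * (1 + ‖x‖ + ‖x‖)).toNNReal (Sig x) := fun x =>
    LipschitzWith.of_dist_le' fun y₁ y₂ => by
      simpa [dist_eq_norm] using hSLip x x y₁ y₂
  have hint : ∀ x x', Integrable (Sig x) (μ x') := fun x x' =>
    (hlip x).integrable_of_integrable_norm (hnorm x')
  have hbound : ∀ x₁ x₂, ‖(∫ y, Sig x₁ y ∂(μ x₁)) - ∫ y, Sig x₂ y ∂(μ x₂)‖ ≤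
      C * (2 * C₂ + 1) * (1 + ‖x₁‖ + ‖x₂‖) * ‖x₁ - x₂‖ := by
    intro x₁ x₂
    have hmeasure := norm_integral_sub_integral_le_of_lipschitzWith
      (fun L g hg => (hwass L g hg x₁ x₂).trans_eq (mul_assoc _ _ _))
      (hlip x₁) (hint x₁ x₁) (hint x₁ x₂)
    rw [Real.coe_toNNReal _ (by positivity)] at hmeasure
    have hcoeff : ‖(∫ y, Sig x₁ y ∂(μ x₂)) - ∫ y, Sig x₂ y ∂(μ x₂)‖ ≤
        C * (1 + ‖x₁‖ + ‖x₂‖) * ‖x₁ - x₂‖ := by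
      rw [← integral_sub (hint x₁ x₂) (hint x₂ x₂)]
      simpa using norm_integral_le_of_norm_le_const (μ := μ x₂)
        (ae_of_all _ fun y => by simpa using hSLip x₁ x₂ y y)
    have hslack : 0 ≤ C * (1 + 2 * ‖x₂‖) * (C₂ * ‖x₁ - x₂‖) := by positivity
    linarith [norm_sub_le_norm_sub_add_norm_sub (∫ y, Sig x₁ y ∂(μ x₁))
      (∫ y, Sig x₁ y ∂(μ x₂)) (∫ y, Sig x₂ y ∂(μ x₂))]
  set K := C * (2 * C₂ + 1)
  have hKpos : 0 < K := by positivity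
  set M := ‖∫ y, Sig 0 y ∂(μ 0)‖
  have hM : 0 ≤ M := norm_nonneg _
  refine ⟨2 * K + M, by positivity, fun x₁ x₂ => (hbound x₁ x₂).trans ?_, fun x => ?_,
    fun x z => ?_⟩
  · gcongr
    linarith
  · have h := hbound x 0
    rw [norm_zero, add_zero, sub_zero] at h
    have htri := norm_le_norm_sub_add (∫ y, Sig x y ∂(μ x)) (∫ y, Sig 0 y ∂(μ 0))
    nlinarith [mul_nonneg hKpos.le (sq_nonneg (‖x‖ - 1)), mul_nonneg hM (sq_nonneg ‖x‖),
      mul_nonneg hKpos.le (sq_nonneg ‖x‖)]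
  · have hz := (hint x x).apply_continuousLinearMap z
    rw [ContinuousLinearMap.integral_apply (hint x x), real_inner_comm, ← integral_inner hz]
    calc c * ‖z‖ ^ 2 = ∫ _, c * ‖z‖ ^ 2 ∂(μ x) := by simp
      _ ≤ ∫ y, ⟪z, Sig x y z⟫ ∂(μ x) :=
        integral_mono (integrable_const _) (hz.const_inner z) fun y =>
          (hSpos x y z).trans_eq (real_inner_comm _ _)
end
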